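/- Let T ⊆ B(H,K) be a TRO and X ⊆ T a nondegenerate sub-TRO, i.e. ⟨X T* T⟩ = T and ⟨T T* X⟩ = T. Then ⟨X X* T⟩ = T and ⟨T X* X⟩ = T. -/

import Mathlib

noncomputable section

open ContinuousLinearMap

/-- The closed linear span of a set in a complex normed space. -/
def cspan {V : Type*} [NormedAddCommGroup V] [NormedSpace ℂ V] (S : Set V) : Set V :=
  closure (Submodule.span ℂ S : Set V)

variable {H K : Type*} [NormedAddCommGroup H] [InnerProductSpace ℂ H] [CompleteSpace H]
  [NormedAddCommGroup K] [InnerProductSpace ℂ K] [CompleteSpace K]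

/-- The ternary product `a b* c` of operators in `B(H,K)`. -/
def tp (a b c : H →L[ℂ] K) : H →L[ℂ] K :=
  a ∘L ((ContinuousLinearMap.adjoint b) ∘L c)

/-- A TRO: a norm-closed linear subspace of `B(H,K)` stable under `(a,b,c) ↦ a b* c`. -/
def IsTRO (T : Set (H →L[ℂ] K)) : Prop :=
  IsClosed T ∧ (∃ S : Submodule ℂ (H →L[ℂ] K), T = ↑S) ∧
    ∀ a ∈ T, ∀ b ∈ T, ∀ c ∈ T, tp a b c ∈ T

/-- A sub-TRO of `T`: a norm-closed linear subspace of `T` stable under the ternary product. -/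
def IsSubTRO (T X : Set (H →L[ℂ] K)) : Prop :=
  X ⊆ T ∧ IsClosed X ∧ (∃ S : Submodule ℂ (H →L[ℂ] K), X = ↑S) ∧
    ∀ a ∈ X, ∀ b ∈ X, ∀ c ∈ X, tp a b c ∈ X

/-- The set `{a b* : a ∈ T₁, b ∈ T₂} ⊆ B(K)`. -/
def setMulStar (T₁ T₂ : Set (H →L[ℂ] K)) : Set (K →L[ℂ] K) :=
  {w | ∃ a ∈ T₁, ∃ b ∈ T₂, w = a ∘L ContinuousLinearMap.adjoint b}

/-- The set `{a* b : a ∈ T₁, b ∈ T₂} ⊆ B(H)`. -/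
def setStarMul (T₁ T₂ : Set (H →L[ℂ] K)) : Set (H →L[ℂ] H) :=
  {w | ∃ a ∈ T₁, ∃ b ∈ T₂, w = ContinuousLinearMap.adjoint a ∘L b}

/-- Nondegeneracy of a sub-TRO `X ⊆ T`: `⟨X T* T⟩ = T` and `⟨T T* X⟩ = T`. -/
def Nondegenerate (T X : Set (H →L[ℂ] K)) : Prop :=
  cspan {w | ∃ x ∈ X, ∃ a ∈ T, ∃ b ∈ T, w = tp x a b} = T ∧
  cspan {w | ∃ a ∈ T, ∃ b ∈ T, ∃ x ∈ X, w = tp a b x} = T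

/-- A TRO conditional expectation from `T` onto the sub-TRO `X`: a linear idempotent
surjection `P : T → X` (formalised as a map of the ambient space which is linear on `T`,
maps `T` into `X` and fixes `X`) satisfying the three module identities. -/
def IsTROCondExp (T X : Set (H →L[ℂ] K)) (P : (H →L[ℂ] K) → (H →L[ℂ] K)) : Prop :=
  (∀ s ∈ T, ∀ t ∈ T, P (s + t) = P s + P t) ∧
  (∀ (z : ℂ), ∀ t ∈ T, P (z • t) = z • P t) ∧
  (∀ t ∈ T, P t ∈ X) ∧ (∀ x ∈ X, P x = x) ∧
  (∀ a ∈ T, ∀ x ∈ X, ∀ y ∈ X, P (tp a x y) = tp (P a) x y) ∧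
  (∀ a ∈ T, ∀ x ∈ X, ∀ y ∈ X, P (tp x a y) = tp x (P a) y) ∧
  (∀ a ∈ T, ∀ x ∈ X, ∀ y ∈ X, P (tp x y a) = tp x y (P a))

/-- `P` is contractive on the set `S`. -/
def ContractiveOn {V W : Type*} [Norm V] [Norm W] (S : Set V) (P : V → W) : Prop :=
  ∀ v ∈ S, ‖P v‖ ≤ ‖v‖

/-- In a C⋆-algebra, `c (1 - c) ^ m` tends to zero at rate `1 / (m + 1)` for a positive
contraction `c`. -/
theorem norm_mul_one_sub_pow_le {A : Type*} [CStarAlgebra A] [PartialOrder A] [StarOrderedRing A]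
    {c : A} (hc : 0 ≤ c) (hc1 : ‖c‖ ≤ 1) (m : ℕ) :
    ‖c * (1 - c) ^ m‖ ≤ 1 / ((m : ℝ) + 1) := by
  rcases subsingleton_or_nontrivial A with _ | _
  · rw [Subsingleton.elim (c * (1 - c) ^ m) 0, norm_zero]
    positivity
  have hpoly : c * (1 - c) ^ m =
      cfc (Polynomial.eval · (Polynomial.X * (1 - Polynomial.X) ^ m : Polynomial ℝ)) c := by
    rw [cfc_polynomial _ c (IsSelfAdjoint.of_nonneg hc)]
    simp
  rw [hpoly]
  refine norm_cfc_le (by positivity) fun t ht ↦ ?_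
  have ht0 : 0 ≤ t := spectrum_nonneg_of_nonneg hc ht
  have ht1 : t ≤ 1 := (le_abs_self t).trans ((spectrum.norm_le_norm_of_mem ht).trans hc1)
  have hs : 0 ≤ 1 - t := by linarith
  have hbern : 1 + m * t ≤ (1 + t) ^ m := one_add_mul_le_pow (by linarith) m
  have hprod : (1 + t) ^ m * (1 - t) ^ m ≤ 1 := by
    rw [← mul_pow]
    exact pow_le_one₀ (by positivity) (by nlinarith)
  have hpow : 0 ≤ (1 - t) ^ m := by positivity
  have heval : Polynomial.eval t (Polynomial.X * (1 - Polynomial.X) ^ m : Polynomial ℝ) =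
      t * (1 - t) ^ m := by simp
  rw [heval, Real.norm_of_nonneg (by positivity), le_div_iff₀ (by positivity)]
  calc t * (1 - t) ^ m * (m + 1) = (t + m * t) * (1 - t) ^ m := by ring
    _ ≤ (1 + m * t) * (1 - t) ^ m := by gcongr
    _ ≤ (1 + t) ^ m * (1 - t) ^ m := by gcongr
    _ ≤ 1 := hprod

/-- For a contraction `x`, the operators `x (1 - x* x) ^ n` tend to zero. -/
theorem tendsto_comp_one_sub_pow {x : H →L[ℂ] K} (hx : ‖x‖ ≤ 1) :
    Filter.Tendsto (fun n : ℕ ↦ x ∘L (1 - adjoint x ∘L x) ^ n) Filter.atTop (nhds 0) := by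
  set c : H →L[ℂ] H := adjoint x ∘L x with hcdef
  have hc : 0 ≤ c := (nonneg_iff_isPositive c).2 (isPositive_adjoint_comp_self x)
  have hc1 : ‖c‖ ≤ 1 := by
    rw [hcdef, norm_adjoint_comp_self]
    exact mul_le_one₀ hx (norm_nonneg x) hx
  have hself : ∀ n : ℕ, adjoint ((1 - c) ^ n) = (1 - c) ^ n := fun n ↦
    (((IsSelfAdjoint.one _).sub (IsSelfAdjoint.of_nonneg hc)).pow n).star_eq
  have hcomm : ∀ n : ℕ, Commute ((1 - c) ^ n) c := fun n ↦
    ((Commute.one_left c).sub_left (Commute.refl c)).pow_left n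
  have hsq : ∀ n : ℕ, ‖x ∘L (1 - c) ^ n‖ * ‖x ∘L (1 - c) ^ n‖ ≤ 1 / ((n : ℝ) + 1) := fun n ↦ by
    have hprod : adjoint (x ∘L (1 - c) ^ n) ∘L (x ∘L (1 - c) ^ n) = c * (1 - c) ^ (n + n) := by
      rw [adjoint_comp, hself, pow_add, ← mul_assoc, ← (hcomm n).eq]
      rfl
    rw [← norm_adjoint_comp_self, hprod]
    refine (norm_mul_one_sub_pow_le hc hc1 (n + n)).trans ?_
    push_cast
    gcongr
    linarith [(n.cast_nonneg : (0 : ℝ) ≤ n)]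
  rw [tendsto_zero_iff_norm_tendsto_zero]
  have hlim := squeeze_zero (fun n ↦ by positivity) hsq tendsto_one_div_add_atTop_nhds_zero_nat
  simpa [Real.sqrt_mul_self (norm_nonneg _)] using hlim.sqrt

theorem subset_cspan {V : Type*} [NormedAddCommGroup V] [NormedSpace ℂ V] (S : Set V) :
    S ⊆ cspan S :=
  Submodule.subset_span.trans subset_closure

theorem cspan_subset_of_isClosed {V : Type*} [NormedAddCommGroup V] [NormedSpace ℂ V]
    {S : Set V} {M : Submodule ℂ V} (hM : IsClosed (M : Set V)) (hS : S ⊆ M) :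
    cspan S ⊆ M :=
  closure_minimal (Submodule.span_le.2 hS) hM

theorem cspan_subset_cspan {V : Type*} [NormedAddCommGroup V] [NormedSpace ℂ V]
    {S S' : Set V} (h : S ⊆ cspan S') : cspan S ⊆ cspan S' :=
  cspan_subset_of_isClosed (M := (Submodule.span ℂ S').topologicalClosure)
    (Submodule.isClosed_topologicalClosure _) h

/-- A continuous linear map sends the closed span of `S` into a closed span containing the
image of `S`. -/
theorem map_mem_cspan {V W : Type*} [NormedAddCommGroup V] [NormedSpace ℂ V]
    [NormedAddCommGroup W] [NormedSpace ℂ W] (f : V →L[ℂ] W) {S : Set V} {S' : Set W}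
    (h : ∀ v ∈ S, f v ∈ cspan S') {v : V} (hv : v ∈ cspan S) : f v ∈ cspan S' :=
  cspan_subset_of_isClosed
    (M := (Submodule.span ℂ S').topologicalClosure.comap (f : V →ₗ[ℂ] W))
    ((Submodule.isClosed_topologicalClosure _).preimage f.continuous) h hv

/-- A subspace `M` stable under the ternary product satisfies `M ⊆ ⟨M M* M⟩`. -/
theorem mem_cspan_tp {M : Submodule ℂ (H →L[ℂ] K)}
    (hM : ∀ a ∈ M, ∀ b ∈ M, ∀ c ∈ M, tp a b c ∈ M) {x : H →L[ℂ] K} (hx : x ∈ M) :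
    x ∈ cspan {w | ∃ a ∈ M, ∃ b ∈ M, ∃ c ∈ M, w = tp a b c} := by
  wlog hx1 : ‖x‖ ≤ 1 generalizing x
  · have hx0 : (‖x‖ : ℂ) ≠ 0 := by
      intro h
      have hzero : ‖x‖ = 0 := by exact_mod_cast h
      exact hx1 (hzero.trans_le zero_le_one)
    have hy := this (M.smul_mem (‖x‖ : ℂ)⁻¹ hx) (by
      rw [norm_smul, norm_inv, Complex.norm_real, norm_norm]
      exact inv_mul_le_one)
    have hmem := (Submodule.span ℂ _).topologicalClosure.smul_mem (‖x‖ : ℂ) hy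
    rwa [smul_inv_smul₀ hx0] at hmem
  set c : H →L[ℂ] H := adjoint x ∘L x with hcdef
  have hstep : ∀ n : ℕ, x ∘L (1 - c) ^ (n + 1) =
      x ∘L (1 - c) ^ n - tp (x ∘L (1 - c) ^ n) x x := fun n ↦ by
    rw [pow_succ, mul_sub, mul_one, comp_sub]
    rfl
  have hu : ∀ n : ℕ, x ∘L (1 - c) ^ n ∈ M := fun n ↦ by
    induction n with
    | zero => simpa [one_def] using hx
    | succ n ih =>
      rw [hstep]
      exact M.sub_mem ih (hM _ ih _ hx _ hx)
  have hdiff : ∀ n : ℕ, x - x ∘L (1 - c) ^ n ∈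
      Submodule.span ℂ {w | ∃ a ∈ M, ∃ b ∈ M, ∃ c ∈ M, w = tp a b c} := fun n ↦ by
    induction n with
    | zero => simp [one_def]
    | succ n ih =>
      rw [hstep, sub_sub_eq_add_sub, add_sub_right_comm]
      exact Submodule.add_mem _ ih
        (Submodule.subset_span ⟨_, hu n, x, hx, x, hx, rfl⟩)
  refine mem_closure_of_tendsto (b := Filter.atTop) (f := fun n : ℕ ↦ x - x ∘L (1 - c) ^ n) ?_
    (Filter.Eventually.of_forall hdiff)
  simpa using (tendsto_comp_one_sub_pow hx1).const_sub x

/-- If `X ⊆ T` is a nondegenerate sub-TRO then `⟨X X* T⟩ = T` and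
`⟨T X* X⟩ = T`. -/
theorem nondegenerate_spans
    (T X : Set (H →L[ℂ] K)) (hT : IsTRO T) (hX : IsSubTRO T X)
    (hXnd : Nondegenerate T X) :
    cspan {w | ∃ x ∈ X, ∃ y ∈ X, ∃ a ∈ T, w = tp x y a} = T ∧
    cspan {w | ∃ a ∈ T, ∃ x ∈ X, ∃ y ∈ X, w = tp a x y} = T := by
  obtain ⟨hTc, ⟨N, rfl⟩, hN⟩ := hT
  obtain ⟨hXT, -, ⟨M, rfl⟩, hM⟩ := hX
  constructor
  · apply subset_antisymm
    · refine cspan_subset_of_isClosed hTc ?_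
      rintro _ ⟨x, hx, y, hy, a, ha, rfl⟩
      exact hN _ (hXT hx) _ (hXT hy) _ ha
    · conv_lhs => rw [← hXnd.1]
      refine cspan_subset_cspan ?_
      rintro _ ⟨x, hx, a, ha, b, hb, rfl⟩
      refine map_mem_cspan ((compL ℂ H H K).flip (adjoint a ∘L b)) ?_ (mem_cspan_tp hM hx)
      rintro _ ⟨u, hu, v, hv, w, hw, rfl⟩
      exact subset_cspan _ ⟨u, hu, v, hv, tp w a b, hN _ (hXT hw) _ ha _ hb, rfl⟩
  · apply subset_antisymm
    · refine cspan_subset_of_isClosed hTc ?_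
      rintro _ ⟨a, ha, x, hx, y, hy, rfl⟩
      exact hN _ ha _ (hXT hx) _ (hXT hy)
    · conv_lhs => rw [← hXnd.2]
      refine cspan_subset_cspan ?_
      rintro _ ⟨a, ha, b, hb, x, hx, rfl⟩
      refine map_mem_cspan (compL ℂ H K K (a ∘L adjoint b)) ?_ (mem_cspan_tp hM hx)
      rintro _ ⟨u, hu, v, hv, w, hw, rfl⟩
      exact subset_cspan _ ⟨tp a b u, hN _ ha _ hb _ (hXT hu), v, hv, w, hw, rfl⟩
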